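/- arXiv:2407.06389 — 2 statements merged into one kernel-verified Lean document; each statement's English description precedes it below -/
import Mathlib

section
/- Let X and Y be separable metric spaces and let c : X×Y → ℝ be a continuous cost such that ∫ c dγⁿ → ∫ c dγ along weakly convergent sequences of couplings with 2-Wasserstein convergent marginals (e.g. c bounded continuous, or c of at most quadratic growth). Then the set-valued map (μ,ν) ↦ Γ_o(μ,ν) := argmin_{γ∈Γ(μ,ν)} ∫_{X×Y} c dγ is upper semi-continuous: if μₙ → μ in P₂(X), νₙ → ν in P₂(Y), γⁿ ∈ Γ_o(μₙ,νₙ), and γⁿ → γ weakly, then γ ∈ Γ_o(μ,ν). -/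
open MeasureTheory ENNReal Filter Topology

noncomputable section

/-- The set of couplings (transport plans) between two measures. -/
def couplings {X Y : Type*} [MeasurableSpace X] [MeasurableSpace Y]
    (μ : Measure X) (ν : Measure Y) : Set (Measure (X × Y)) :=
  {γ | γ.map Prod.fst = μ ∧ γ.map Prod.snd = ν}

/-- Optimal transport cost between `μ` and `ν` for the cost `c`. -/
def minCost {X Y : Type*} [MeasurableSpace X] [MeasurableSpace Y]
    (c : X → Y → ℝ≥0∞) (μ : Measure X) (ν : Measure Y) : ℝ≥0∞ :=
  ⨅ γ ∈ couplings μ ν, ∫⁻ p, c p.1 p.2 ∂γ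

/-- The 2-Wasserstein distance on a metric space. -/
def W2 {Z : Type*} [MeasurableSpace Z] [PseudoEMetricSpace Z] (μ ν : Measure Z) : ℝ :=
  Real.sqrt (minCost (fun x y => edist x y ^ 2) μ ν).toReal

/-- `P₂(Z)`: Borel probability measures with finite second moment on a metric space. -/
def P2m (Z : Type*) [MeasurableSpace Z] [PseudoEMetricSpace Z] : Set (Measure Z) :=
  {μ | IsProbabilityMeasure μ ∧ ∃ x₀ : Z, ∫⁻ x, edist x x₀ ^ 2 ∂μ < ⊤}

/-- Weak convergence of measures: convergence of integrals of bounded continuous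
functions. -/
def TendstoWeakly {Z : Type*} [MeasurableSpace Z] [TopologicalSpace Z]
    (γn : ℕ → Measure Z) (γ : Measure Z) : Prop :=
  ∀ g : BoundedContinuousFunction Z ℝ,
    Tendsto (fun n => ∫ x, g x ∂(γn n)) atTop (𝓝 (∫ x, g x ∂γ))

/-- The set of couplings of `μ` and `ν` that minimize the (real-valued) cost `c`. -/
def optCouplingsReal {X Y : Type*} [MeasurableSpace X] [MeasurableSpace Y]
    (c : X × Y → ℝ) (μ : Measure X) (ν : Measure Y) : Set (Measure (X × Y)) :=
  {γ | γ ∈ couplings μ ν ∧ ∀ γ' ∈ couplings μ ν, ∫ p, c p ∂γ ≤ ∫ p, c p ∂γ'}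

theorem sum_restrict_fiber {R : Type*} [MeasurableSpace R] (m : Measure R) {k : R → ℕ}
    (hk : ∀ n, MeasurableSet (k ⁻¹' {n})) :
    Measure.sum (fun n => m.restrict (k ⁻¹' {n})) = m := by
  rw [← Measure.restrict_iUnion _ hk]
  · rw [← Set.preimage_iUnion, Set.iUnion_of_singleton, Set.preimage_univ, Measure.restrict_univ]
  · intro i j hij
    exact Disjoint.preimage k (by simpa using hij)

/-- Two finite measures with the same image under countably-valued maps admit a coupling
concentrated on the fibre product of these maps. -/
theorem exists_coupling_ae_eq {P Q : Type*} [MeasurableSpace P] [MeasurableSpace Q]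
    (γ : Measure P) (π : Measure Q) [IsFiniteMeasure γ] [IsFiniteMeasure π]
    {f : P → ℕ} {g : Q → ℕ} (hf : Measurable f) (hg : Measurable g)
    (h : γ.map f = π.map g) :
    ∃ Θ ∈ couplings γ π, ∀ᵐ p ∂Θ, f p.1 = g p.2 := by
  have hA : ∀ n, MeasurableSet (f ⁻¹' {n}) := fun n => hf (measurableSet_singleton n)
  have hB : ∀ n, MeasurableSet (g ⁻¹' {n}) := fun n => hg (measurableSet_singleton n)
  have hAB : ∀ n, γ (f ⁻¹' {n}) = π (g ⁻¹' {n}) := fun n => by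
    rw [← Measure.map_apply hf (measurableSet_singleton n), h,
      Measure.map_apply hg (measurableSet_singleton n)]
  refine ⟨Measure.sum fun n => (π (g ⁻¹' {n}))⁻¹ •
    (γ.restrict (f ⁻¹' {n})).prod (π.restrict (g ⁻¹' {n})), ⟨?_, ?_⟩, ?_⟩
  · rw [Measure.map_sum measurable_fst.aemeasurable]
    conv_rhs => rw [← sum_restrict_fiber γ hA]
    congr 1
    funext n
    rw [Measure.map_smul, Measure.map_fst_prod, smul_smul, Measure.restrict_apply_univ]
    by_cases h0 : π (g ⁻¹' {n}) = 0
    · rw [Measure.restrict_eq_zero.2 ((hAB n).trans h0), smul_zero]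
    · rw [ENNReal.inv_mul_cancel h0 (measure_ne_top _ _), one_smul]
  · rw [Measure.map_sum measurable_snd.aemeasurable]
    conv_rhs => rw [← sum_restrict_fiber π hB]
    congr 1
    funext n
    rw [Measure.map_smul, Measure.map_snd_prod, smul_smul, Measure.restrict_apply_univ, hAB]
    by_cases h0 : π (g ⁻¹' {n}) = 0
    · rw [Measure.restrict_eq_zero.2 h0, smul_zero]
    · rw [ENNReal.inv_mul_cancel h0 (measure_ne_top _ _), one_smul]
  · have hs : MeasurableSet {p : P × Q | f p.1 = g p.2} :=
      measurableSet_eq_fun (hf.comp measurable_fst) (hg.comp measurable_snd)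
    rw [Measure.ae_sum_iff' hs]
    intro n
    refine Measure.ae_smul_measure ?_ _
    rw [Measure.prod_restrict]
    filter_upwards [ae_restrict_mem ((hA n).prod (hB n))] with p hp
    exact hp.1.trans hp.2.symm

/-- A nonempty separable space has a countable measurable partition of arbitrarily fine mesh. -/
theorem exists_measurable_nat_edist_le (X : Type*) [PseudoEMetricSpace X]
    [TopologicalSpace.SeparableSpace X] [Nonempty X] [MeasurableSpace X]
    [OpensMeasurableSpace X] {ε : ℝ≥0∞} (hε : ε ≠ 0) :
    ∃ f : X → ℕ, Measurable f ∧ ∀ x y, f x = f y → edist x y ≤ ε + ε := by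
  classical
  have hex : ∀ x : X, ∃ n, edist x (TopologicalSpace.denseSeq X n) < ε := fun x => by
    obtain ⟨_, ⟨n, rfl⟩, hn⟩ :=
      EMetric.mem_closure_iff.1 (TopologicalSpace.denseRange_denseSeq X x) ε hε.bot_lt
    exact ⟨n, hn⟩
  refine ⟨fun x => Nat.find (hex x), measurable_find hex fun k => ?_, fun x y hxy => ?_⟩
  · exact (isOpen_lt (by fun_prop) continuous_const).measurableSet
  · have hx := Nat.find_spec (hex x)
    have hy := Nat.find_spec (hex y)
    simp only at hxy
    rw [← hxy] at hy
    exact (edist_triangle_right _ _ _).trans (add_le_add hx.le hy.le)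

theorem isProbabilityMeasure_of_mem_couplings {X Y : Type*} [MeasurableSpace X]
    [MeasurableSpace Y] {μ : Measure X} {ν : Measure Y} {γ : Measure (X × Y)}
    [hμ : IsProbabilityMeasure μ] (h : γ ∈ couplings μ ν) : IsProbabilityMeasure γ := by
  rw [← h.1] at hμ
  exact Measure.isProbabilityMeasure_of_map Prod.fst

/-- A coupling of `μ` and `ν` is transported along couplings `π` of `μ', μ` and `ρ` of `ν', ν`
to a coupling of `μ'` and `ν'`, up to an arbitrarily small error. -/
theorem exists_transported_coupling {X Y : Type*}
    [PseudoEMetricSpace X] [SecondCountableTopology X] [MeasurableSpace X] [BorelSpace X]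
    [PseudoEMetricSpace Y] [SecondCountableTopology Y] [MeasurableSpace Y] [BorelSpace Y]
    {μ μ' : Measure X} {ν ν' : Measure Y} [IsProbabilityMeasure μ] [IsProbabilityMeasure ν]
    [IsProbabilityMeasure μ'] [IsProbabilityMeasure ν']
    {γ : Measure (X × Y)} {π : Measure (X × X)} {ρ : Measure (Y × Y)}
    (hγ : γ ∈ couplings μ ν) (hπ : π ∈ couplings μ' μ) (hρ : ρ ∈ couplings ν' ν)
    {ε : ℝ≥0∞} (hε : ε ≠ 0) :
    ∃ γ' ∈ couplings μ' ν', ∃ Θ ∈ couplings γ' γ,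
      ∫⁻ p, edist p.1 p.2 ∂Θ ≤
        (∫⁻ p, edist p.1 p.2 ∂π + (ε + ε)) + (∫⁻ p, edist p.1 p.2 ∂ρ + (ε + ε)) := by
  have := isProbabilityMeasure_of_mem_couplings hγ
  have := isProbabilityMeasure_of_mem_couplings hπ
  have := isProbabilityMeasure_of_mem_couplings hρ
  have : Nonempty X := nonempty_of_isProbabilityMeasure μ
  have : Nonempty Y := nonempty_of_isProbabilityMeasure ν
  obtain ⟨f, hf, hfε⟩ := exists_measurable_nat_edist_le X hε
  obtain ⟨g, hg, hgε⟩ := exists_measurable_nat_edist_le Y hε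
  obtain ⟨Ξ, hΞ, hΞf⟩ := exists_coupling_ae_eq γ π (hf.comp measurable_fst)
    (hf.comp measurable_snd) (by
      rw [← Measure.map_map hf measurable_fst, ← Measure.map_map hf measurable_snd, hγ.1, hπ.2])
  have := isProbabilityMeasure_of_mem_couplings hΞ
  obtain ⟨Ω, hΩ, hΩg⟩ := exists_coupling_ae_eq Ξ ρ
    (hg.comp (measurable_snd.comp measurable_fst)) (hg.comp measurable_snd) (by
      rw [← Measure.map_map hg (by fun_prop), ← Measure.map_map hg measurable_snd,
        ← Measure.map_map measurable_snd measurable_fst, hΞ.1, hγ.2, hρ.2])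
  have := isProbabilityMeasure_of_mem_couplings hΩ
  have hΩf : ∀ᵐ q ∂Ω, f q.1.1.1 = f q.1.2.2 := by
    rw [← hΩ.1] at hΞf
    exact ae_of_ae_map measurable_fst.aemeasurable hΞf
  have hΩπ : Ω.map (fun q => q.1.2) = π := by
    rw [← hΞ.2, ← hΩ.1, Measure.map_map measurable_snd measurable_fst]; rfl
  refine ⟨Ω.map fun q => (q.1.2.1, q.2.1), ⟨?_, ?_⟩,
    Ω.map fun q => ((q.1.2.1, q.2.1), q.1.1), ⟨?_, ?_⟩, ?_⟩
  · rw [Measure.map_map measurable_fst (by fun_prop), ← hπ.1, ← hΩπ,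
      Measure.map_map measurable_fst (by fun_prop)]; rfl
  · rw [Measure.map_map measurable_snd (by fun_prop), ← hρ.1, ← hΩ.2,
      Measure.map_map measurable_fst (by fun_prop)]; rfl
  · rw [Measure.map_map measurable_fst (by fun_prop)]; rfl
  · rw [Measure.map_map measurable_snd (by fun_prop), ← hΞ.1, ← hΩ.1,
      Measure.map_map measurable_fst (by fun_prop)]; rfl
  · rw [lintegral_map measurable_edist (by fun_prop)]
    calc ∫⁻ q, edist (q.1.2.1, q.2.1) q.1.1 ∂Ω
        ≤ ∫⁻ q, (edist q.1.2.1 q.1.2.2 + (ε + ε)) + (edist q.2.1 q.2.2 + (ε + ε)) ∂Ω := by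
          refine lintegral_mono_ae ?_
          filter_upwards [hΩf, hΩg] with q hq₁ hq₂
          rw [Prod.edist_eq]
          refine (max_le_add_of_nonneg zero_le zero_le).trans (add_le_add ?_ ?_)
          · exact (edist_triangle _ _ _).trans (by gcongr; exact hfε _ _ hq₁.symm)
          · exact (edist_triangle _ _ _).trans (by gcongr; exact hgε _ _ hq₂.symm)
      _ = _ := by
          rw [← hΩ.2, ← hΩπ, lintegral_map measurable_edist (by fun_prop),
            lintegral_map measurable_edist (by fun_prop), lintegral_add_left (by fun_prop),
            lintegral_add_left (by fun_prop), lintegral_add_left (by fun_prop)]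
          simp

theorem abs_integral_sub_le_of_mem_couplings {Z : Type*} [PseudoMetricSpace Z]
    [SecondCountableTopology Z] [MeasurableSpace Z] [BorelSpace Z]
    {μ ν : Measure Z} [IsProbabilityMeasure μ] [IsProbabilityMeasure ν]
    {Θ : Measure (Z × Z)} (hΘ : Θ ∈ couplings μ ν) {L : NNReal} {g : Z → ℝ}
    (hg : LipschitzWith L g) (hgb : ∃ C : ℝ, ∀ x y, dist (g x) (g y) ≤ C) {r : ℝ}
    (hr : 0 ≤ r) (h : ∫⁻ p, edist p.1 p.2 ∂Θ ≤ ENNReal.ofReal r) :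
    |∫ x, g x ∂μ - ∫ x, g x ∂ν| ≤ L * r := by
  have := isProbabilityMeasure_of_mem_couplings hΘ
  have : Nonempty Z := nonempty_of_isProbabilityMeasure μ
  have hint : ∀ (m : Measure Z) [IsProbabilityMeasure m], Integrable g m := fun m _ => by
    obtain ⟨C, hC⟩ := hgb
    let z : Z := Classical.arbitrary Z
    refine Integrable.of_bound hg.continuous.aestronglyMeasurable (C + ‖g z‖)
      (Eventually.of_forall fun x => ?_)
    calc ‖g x‖ = ‖(g x - g z) + g z‖ := by rw [sub_add_cancel]
      _ ≤ ‖g x - g z‖ + ‖g z‖ := norm_add_le _ _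
      _ ≤ C + ‖g z‖ := by gcongr; rw [← dist_eq_norm]; exact hC x z
  have h₁ : Integrable (fun p : Z × Z => g p.1) Θ :=
    (hΘ.1 ▸ hint μ : Integrable g (Θ.map Prod.fst)).comp_measurable measurable_fst
  have h₂ : Integrable (fun p : Z × Z => g p.2) Θ :=
    (hΘ.2 ▸ hint ν : Integrable g (Θ.map Prod.snd)).comp_measurable measurable_snd
  rw [← hΘ.1, ← hΘ.2, integral_map measurable_fst.aemeasurable
      hg.continuous.aestronglyMeasurable, integral_map measurable_snd.aemeasurable
      hg.continuous.aestronglyMeasurable, ← integral_sub h₁ h₂, ← Real.norm_eq_abs]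
  rw [← ENNReal.ofReal_le_ofReal_iff (by positivity), ofReal_norm]
  calc ‖∫ p, g p.1 - g p.2 ∂Θ‖ₑ ≤ ∫⁻ p, ‖g p.1 - g p.2‖ₑ ∂Θ := enorm_integral_le_lintegral_enorm _
    _ ≤ ∫⁻ p, L * edist p.1 p.2 ∂Θ := by
        refine lintegral_mono fun p => ?_
        rw [← edist_eq_enorm_sub]
        exact hg _ _
    _ = L * ∫⁻ p, edist p.1 p.2 ∂Θ := lintegral_const_mul _ measurable_edist
    _ ≤ ENNReal.ofReal (L * r) := by
        rw [ENNReal.ofReal_mul (NNReal.coe_nonneg L), ENNReal.ofReal_coe_nnreal]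
        gcongr

theorem prod_mem_couplings {X Y : Type*} [MeasurableSpace X] [MeasurableSpace Y]
    (μ : Measure X) (ν : Measure Y) [IsProbabilityMeasure μ] [IsProbabilityMeasure ν] :
    μ.prod ν ∈ couplings μ ν := by
  constructor <;> simp [Measure.map_fst_prod, Measure.map_snd_prod]

theorem minCost_edist_sq_lt_top {Z : Type*} [PseudoMetricSpace Z] [SecondCountableTopology Z]
    [MeasurableSpace Z] [BorelSpace Z] {μ ν : Measure Z} (hμ : μ ∈ P2m Z) (hν : ν ∈ P2m Z) :
    minCost (fun x y => edist x y ^ 2) μ ν < ⊤ := by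
  obtain ⟨_, x₀, hx⟩ := hμ
  obtain ⟨_, y₀, hy⟩ := hν
  have hle : ∀ a b : ℝ≥0∞, (a + b) ^ 2 ≤ 4 * (a ^ 2 + b ^ 2) := fun a b => by
    have hmax : ∀ m : ℝ≥0∞, (m + m) ^ 2 = 4 * m ^ 2 := fun m => by ring
    calc (a + b) ^ 2 ≤ (max a b + max a b) ^ 2 := by gcongr <;> simp
      _ = 4 * (max a b) ^ 2 := hmax _
      _ ≤ 4 * (a ^ 2 + b ^ 2) := by
        gcongr
        rcases max_cases a b with ⟨h, _⟩ | ⟨h, _⟩ <;> rw [h] <;> simp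
  have h₁ : ∫⁻ p, edist p.1 x₀ ^ 2 ∂(μ.prod ν) = ∫⁻ x, edist x x₀ ^ 2 ∂μ := by
    conv_rhs => rw [← (prod_mem_couplings μ ν).1, lintegral_map (by fun_prop) measurable_fst]
  have h₂ : ∫⁻ p, edist p.2 y₀ ^ 2 ∂(μ.prod ν) = ∫⁻ y, edist y y₀ ^ 2 ∂ν := by
    conv_rhs => rw [← (prod_mem_couplings μ ν).2, lintegral_map (by fun_prop) measurable_snd]
  refine (iInf₂_le _ (prod_mem_couplings μ ν)).trans_lt ?_
  calc ∫⁻ p, edist p.1 p.2 ^ 2 ∂(μ.prod ν)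
      ≤ ∫⁻ p, 4 * (edist p.1 x₀ ^ 2 + 4 * (edist x₀ y₀ ^ 2 + edist p.2 y₀ ^ 2)) ∂(μ.prod ν) := by
        refine lintegral_mono fun p => ?_
        calc edist p.1 p.2 ^ 2 ≤ (edist p.1 x₀ + (edist x₀ y₀ + edist p.2 y₀)) ^ 2 := by
              gcongr
              refine (edist_triangle _ x₀ _).trans ?_
              gcongr
              exact edist_triangle_right _ _ _
          _ ≤ _ := (hle _ _).trans (by gcongr; exact hle _ _)
    _ = 4 * (∫⁻ x, edist x x₀ ^ 2 ∂μ + 4 * (edist x₀ y₀ ^ 2 + ∫⁻ y, edist y y₀ ^ 2 ∂ν)) := by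
        rw [lintegral_const_mul _ (by fun_prop), lintegral_add_left (by fun_prop),
          lintegral_const_mul _ (by fun_prop), lintegral_add_left (by fun_prop),
          lintegral_const]
        simp only [h₁, h₂, measure_univ, mul_one]
    _ < ⊤ := by
        finiteness

/-- If `W₂(μ, ν) < ε`, there is a coupling of `μ` and `ν` of mean distance at most `2ε`. -/
theorem exists_coupling_lintegral_edist_le {Z : Type*} [PseudoMetricSpace Z]
    [SecondCountableTopology Z] [MeasurableSpace Z] [BorelSpace Z] {μ ν : Measure Z}
    (hμ : μ ∈ P2m Z) (hν : ν ∈ P2m Z) {ε : ℝ} (h : W2 μ ν < ε) :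
    ∃ π ∈ couplings μ ν, ∫⁻ p, edist p.1 p.2 ∂π ≤ ENNReal.ofReal ε + ENNReal.ofReal ε := by
  have hε : 0 < ε := (Real.sqrt_nonneg _).trans_lt h
  have he : ENNReal.ofReal ε ≠ 0 := by simpa using hε
  have hfin := minCost_edist_sq_lt_top hμ hν
  have hlt : minCost (fun x y => edist x y ^ 2) μ ν < ENNReal.ofReal ε ^ 2 := by
    rw [← ENNReal.ofReal_pow hε.le, ENNReal.lt_ofReal_iff_toReal_lt hfin.ne]
    exact (Real.sqrt_lt' hε).1 h
  simp only [minCost, iInf_lt_iff] at hlt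
  obtain ⟨π, hπ, hlt⟩ := hlt
  have := hμ.1
  have := isProbabilityMeasure_of_mem_couplings hπ
  refine ⟨π, hπ, ?_⟩
  set e := ENNReal.ofReal ε
  have he' : e ≠ ⊤ := ENNReal.ofReal_ne_top
  calc ∫⁻ p, edist p.1 p.2 ∂π ≤ ∫⁻ p, e + e⁻¹ * edist p.1 p.2 ^ 2 ∂π := by
        refine lintegral_mono fun p => ?_
        rcases le_total (edist p.1 p.2) e with hp | hp
        · exact hp.trans le_self_add
        · refine le_trans ?_ le_add_self
          rw [← ENNReal.div_eq_inv_mul, ENNReal.le_div_iff_mul_le (.inl he) (.inl he'), sq]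
          gcongr
    _ = e + e⁻¹ * ∫⁻ p, edist p.1 p.2 ^ 2 ∂π := by
        rw [lintegral_add_left measurable_const, lintegral_const_mul _ (by fun_prop)]
        simp
    _ ≤ e + e⁻¹ * e ^ 2 := by gcongr
    _ = e + e := by rw [sq, ← mul_assoc, ENNReal.inv_mul_cancel he he', one_mul]

/-- Every coupling of `W₂`-limits is a weak limit of couplings of the approximating measures. -/
theorem exists_couplings_tendstoWeakly {X Y : Type*}
    [MetricSpace X] [TopologicalSpace.SeparableSpace X] [MeasurableSpace X] [BorelSpace X]
    [MetricSpace Y] [TopologicalSpace.SeparableSpace Y] [MeasurableSpace Y] [BorelSpace Y]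
    {μn : ℕ → Measure X} {μ : Measure X} {νn : ℕ → Measure Y} {ν : Measure Y}
    (hμn : ∀ n, μn n ∈ P2m X) (hμ : μ ∈ P2m X)
    (hνn : ∀ n, νn n ∈ P2m Y) (hν : ν ∈ P2m Y)
    (hμconv : Tendsto (fun n => W2 (μn n) μ) atTop (𝓝 0))
    (hνconv : Tendsto (fun n => W2 (νn n) ν) atTop (𝓝 0))
    {γ : Measure (X × Y)} (hγ : γ ∈ couplings μ ν) :
    ∃ γn : ℕ → Measure (X × Y), (∀ n, γn n ∈ couplings (μn n) (νn n)) ∧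
      TendstoWeakly γn γ := by
  have := UniformSpace.secondCountable_of_separable X
  have := UniformSpace.secondCountable_of_separable Y
  have := hμ.1
  have := hν.1
  have := fun n => (hμn n).1
  have := fun n => (hνn n).1
  have hγP := isProbabilityMeasure_of_mem_couplings hγ
  let ε : ℕ → ℝ := fun n => W2 (μn n) μ + W2 (νn n) ν + 1 / ((n : ℝ) + 1)
  have hεlim : Tendsto ε atTop (𝓝 0) := by
    simpa [ε] using (hμconv.add hνconv).add tendsto_one_div_add_atTop_nhds_zero_nat
  have hW : ∀ n, 0 ≤ W2 (μn n) μ ∧ 0 ≤ W2 (νn n) ν :=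
    fun n => ⟨Real.sqrt_nonneg _, Real.sqrt_nonneg _⟩
  have hinv : ∀ n : ℕ, 0 < 1 / ((n : ℝ) + 1) := fun n => by positivity
  have hεpos : ∀ n, 0 < ε n := fun n => by
    have := hW n; have := hinv n; simp only [ε]; linarith
  have key : ∀ n, ∃ γ' ∈ couplings (μn n) (νn n), ∃ Θ ∈ couplings γ' γ,
      ∫⁻ p, edist p.1 p.2 ∂Θ ≤ ENNReal.ofReal (8 * ε n) := fun n => by
    obtain ⟨π, hπ, hπε⟩ := exists_coupling_lintegral_edist_le (hμn n) hμ (ε := ε n)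
      (by have := hW n; have := hinv n; simp only [ε]; linarith)
    obtain ⟨ρ, hρ, hρε⟩ := exists_coupling_lintegral_edist_le (hνn n) hν (ε := ε n)
      (by have := hW n; have := hinv n; simp only [ε]; linarith)
    obtain ⟨γ', hγ', Θ, hΘ, hle⟩ := exists_transported_coupling hγ hπ hρ
      (ε := ENNReal.ofReal (ε n)) (by simpa using hεpos n)
    refine ⟨γ', hγ', Θ, hΘ, hle.trans ((add_le_add (add_le_add_left hπε _)
      (add_le_add_left hρε _)).trans_eq ?_)⟩
    rw [ENNReal.ofReal_mul (by norm_num)]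
    norm_num
    ring
  choose γn hγn Θ hΘ hle using key
  have hγnP := fun n => isProbabilityMeasure_of_mem_couplings (hγn n)
  refine ⟨γn, hγn, ?_⟩
  let Γn : ℕ → ProbabilityMeasure (X × Y) := fun n => ⟨γn n, hγnP n⟩
  let Γ : ProbabilityMeasure (X × Y) := ⟨γ, hγP⟩
  have hlim : Tendsto Γn atTop (𝓝 Γ) := by
    rw [tendsto_iff_forall_lipschitz_integral_tendsto]
    rintro g hgb ⟨L, hg⟩
    rw [tendsto_iff_dist_tendsto_zero]
    refine squeeze_zero (fun _ => dist_nonneg) (fun n => ?_)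
      (by simpa using (hεlim.const_mul 8).const_mul (L : ℝ))
    rw [Real.dist_eq]
    exact abs_integral_sub_le_of_mem_couplings (hΘ n) hg hgb
      (by have := hεpos n; positivity) (hle n)
  exact ProbabilityMeasure.tendsto_iff_forall_integral_tendsto.1 hlim

/-- Weakly convergent sequences of measures with the same images under a continuous map have
limits with the same image. -/
theorem TendstoWeakly.map_eq_map {Z W : Type*} [TopologicalSpace Z] [MeasurableSpace Z]
    [OpensMeasurableSpace Z] [TopologicalSpace W] [HasOuterApproxClosed W] [MeasurableSpace W]
    [BorelSpace W] {γn γn' : ℕ → Measure Z} {γ γ' : Measure Z} [IsFiniteMeasure γ]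
    [IsFiniteMeasure γ'] (h : TendstoWeakly γn γ) (h' : TendstoWeakly γn' γ') {f : Z → W}
    (hf : Continuous f) (heq : ∀ n, (γn n).map f = (γn' n).map f) :
    γ.map f = γ'.map f := by
  refine ext_of_forall_integral_eq_of_IsFiniteMeasure fun g => ?_
  have hint : ∀ m : Measure Z, ∫ y, g y ∂(m.map f) = ∫ x, g.compContinuous ⟨f, hf⟩ x ∂m :=
    fun m => integral_map hf.measurable.aemeasurable
      g.continuous.measurable.aestronglyMeasurable
  rw [hint, hint]
  refine tendsto_nhds_unique (h _) ((h' _).congr fun n => ?_)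
  rw [← hint, ← hint, heq]

/-- Let `c : X × Y → ℝ` be a continuous cost such that
`∫ c dγⁿ → ∫ c dγ` along weakly convergent sequences of couplings with
`W₂`-convergent marginals. Then `(μ, ν) ↦ Γ_o(μ, ν)` is upper semi-continuous:
if `μₙ → μ`, `νₙ → ν` in `W₂`, `γⁿ ∈ Γ_o(μₙ, νₙ)` and `γⁿ → γ` weakly, then
`γ ∈ Γ_o(μ, ν)`. -/
theorem optimal_couplings_usc {X Y : Type*}
    [MetricSpace X] [TopologicalSpace.SeparableSpace X] [MeasurableSpace X] [BorelSpace X]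
    [MetricSpace Y] [TopologicalSpace.SeparableSpace Y] [MeasurableSpace Y] [BorelSpace Y]
    (c : X × Y → ℝ) (hc : Continuous c)
    (hstab : ∀ (μn : ℕ → Measure X) (μ : Measure X) (νn : ℕ → Measure Y) (ν : Measure Y)
      (γn : ℕ → Measure (X × Y)) (γ : Measure (X × Y)),
      (∀ n, μn n ∈ P2m X) → μ ∈ P2m X → (∀ n, νn n ∈ P2m Y) → ν ∈ P2m Y →
      Tendsto (fun n => W2 (μn n) μ) atTop (𝓝 0) →
      Tendsto (fun n => W2 (νn n) ν) atTop (𝓝 0) →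
      (∀ n, γn n ∈ couplings (μn n) (νn n)) → γ ∈ couplings μ ν →
      TendstoWeakly γn γ →
      Tendsto (fun n => ∫ p, c p ∂(γn n)) atTop (𝓝 (∫ p, c p ∂γ)))
    (μn : ℕ → Measure X) (μ : Measure X) (νn : ℕ → Measure Y) (ν : Measure Y)
    (hμn : ∀ n, μn n ∈ P2m X) (hμ : μ ∈ P2m X)
    (hνn : ∀ n, νn n ∈ P2m Y) (hν : ν ∈ P2m Y)
    (hμconv : Tendsto (fun n => W2 (μn n) μ) atTop (𝓝 0))
    (hνconv : Tendsto (fun n => W2 (νn n) ν) atTop (𝓝 0))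
    (γn : ℕ → Measure (X × Y)) (γ : Measure (X × Y)) (hγP : IsProbabilityMeasure γ)
    (hγn : ∀ n, γn n ∈ optCouplingsReal c (μn n) (νn n))
    (hγconv : TendstoWeakly γn γ) :
    γ ∈ optCouplingsReal c μ ν := by
  have := hμ.1
  have := hν.1
  obtain ⟨ηn, hηn, hηconv⟩ := exists_couplings_tendstoWeakly hμn hμ hνn hν hμconv hνconv
    (prod_mem_couplings μ ν)
  have hγ : γ ∈ couplings μ ν := by
    refine ⟨?_, ?_⟩
    · rw [← (prod_mem_couplings μ ν).1]
      exact hγconv.map_eq_map hηconv continuous_fst fun n => (hγn n).1.1.trans (hηn n).1.symm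
    · rw [← (prod_mem_couplings μ ν).2]
      exact hγconv.map_eq_map hηconv continuous_snd fun n => (hγn n).1.2.trans (hηn n).2.symm
  refine ⟨hγ, fun γ' hγ' => ?_⟩
  obtain ⟨γn', hγn', hγconv'⟩ :=
    exists_couplings_tendstoWeakly hμn hμ hνn hν hμconv hνconv hγ'
  exact le_of_tendsto_of_tendsto'
    (hstab μn μ νn ν γn γ hμn hμ hνn hν hμconv hνconv (fun n => (hγn n).1) hγ hγconv)
    (hstab μn μ νn ν γn' γ' hμn hμ hνn hν hμconv hνconv hγn' hγ' hγconv')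
    fun n => (hγn n).2 _ (hγn' n)

end
end

section
/- In ℝ², let μ¹ = ½(δ_{(0,0)} + δ_{(1,1)}) and μ² = ½(δ_{(0,1)} + δ_{(1,0)}). Then both m¹ = ½(δ_{(0,1/2)} + δ_{(1,1/2)}) and m² = ½(δ_{(1/2,0)} + δ_{(1/2,1)}) minimize the functional ν ↦ ½ W₂²(μ¹, ν) + ½ W₂²(μ², ν) over ν ∈ P₂(ℝ²); in particular, the 2-Wasserstein barycenter of μ¹ and μ² with equal weights is not unique. -/
open MeasureTheory ENNReal Filter Topology

noncomputable section

abbrev E2 := EuclideanSpace ℝ (Fin 2)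

/-- A point of the Euclidean plane. -/
def pt (a b : ℝ) : E2 := (WithLp.equiv 2 (Fin 2 → ℝ)).symm ![a, b]

/-- `μ¹ = ½(δ_{(0,0)} + δ_{(1,1)})`. -/
def muOne : Measure E2 := (2 : ℝ≥0∞)⁻¹ • (Measure.dirac (pt 0 0) + Measure.dirac (pt 1 1))

/-- `μ² = ½(δ_{(0,1)} + δ_{(1,0)})`. -/
def muTwo : Measure E2 := (2 : ℝ≥0∞)⁻¹ • (Measure.dirac (pt 0 1) + Measure.dirac (pt 1 0))

/-- `m¹ = ½(δ_{(0,1/2)} + δ_{(1,1/2)})`. -/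
def mOne : Measure E2 :=
  (2 : ℝ≥0∞)⁻¹ • (Measure.dirac (pt 0 (1/2)) + Measure.dirac (pt 1 (1/2)))

/-- `m² = ½(δ_{(1/2,0)} + δ_{(1/2,1)})`. -/
def mTwo : Measure E2 :=
  (2 : ℝ≥0∞)⁻¹ • (Measure.dirac (pt (1/2) 0) + Measure.dirac (pt (1/2) 1))

/-- The barycenter functional `ν ↦ ½ W₂²(μ¹, ν) + ½ W₂²(μ², ν)`. -/
def baryFun (ν : Measure E2) : ℝ :=
  (1/2) * W2 muOne ν ^ 2 + (1/2) * W2 muTwo ν ^ 2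

/-- Transporting points along `a ↦ a'`, `b ↦ b'` bounds the optimal cost between two-point
measures. -/
lemma minCost_twoPoint_le {X Y : Type*} [MeasurableSpace X] [MeasurableSpace Y]
    [MeasurableSingletonClass X] [MeasurableSingletonClass Y]
    (c : X → Y → ℝ≥0∞) (a b : X) (a' b' : Y) :
    minCost c ((2 : ℝ≥0∞)⁻¹ • (Measure.dirac a + Measure.dirac b))
      ((2 : ℝ≥0∞)⁻¹ • (Measure.dirac a' + Measure.dirac b')) ≤ 2⁻¹ * (c a a' + c b b') := by
  have hγ : (2 : ℝ≥0∞)⁻¹ • (Measure.dirac (a, a') + Measure.dirac (b, b')) ∈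
      couplings ((2 : ℝ≥0∞)⁻¹ • (Measure.dirac a + Measure.dirac b))
        ((2 : ℝ≥0∞)⁻¹ • (Measure.dirac a' + Measure.dirac b')) := by
    constructor
    · rw [Measure.map_smul, Measure.map_add _ _ measurable_fst,
        Measure.map_dirac' measurable_fst, Measure.map_dirac' measurable_fst]
    · rw [Measure.map_smul, Measure.map_add _ _ measurable_snd,
        Measure.map_dirac' measurable_snd, Measure.map_dirac' measurable_snd]
  refine (iInf₂_le _ hγ).trans (le_of_eq ?_)
  simp [lintegral_smul_measure, lintegral_add_measure, mul_add]

/-- The cost of transporting a two-point measure onto `ν` is at least the integral over `ν` of the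
cost to the cheaper of the two points. -/
lemma lintegral_min_le_minCost {X Y : Type*} [MeasurableSpace X] [MeasurableSpace Y]
    [MeasurableSingletonClass X] (c : X → Y → ℝ≥0∞) (a b : X)
    (ha : Measurable (c a)) (hb : Measurable (c b)) (ν : Measure Y) :
    ∫⁻ y, min (c a y) (c b y) ∂ν ≤
      minCost c ((2 : ℝ≥0∞)⁻¹ • (Measure.dirac a + Measure.dirac b)) ν := by
  refine le_iInf₂ fun γ hγ => ?_
  obtain ⟨h₁, h₂⟩ := hγ
  rw [← h₂, lintegral_map (ha.min hb) measurable_snd]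
  refine lintegral_mono_ae ?_
  have hab : ∀ᵐ x ∂(γ.map Prod.fst), x = a ∨ x = b := by
    rw [h₁]
    refine Measure.ae_smul_measure ?_ _
    rw [ae_add_measure_iff]
    simp [ae_dirac_eq]
  filter_upwards [ae_of_ae_map measurable_fst.aemeasurable hab] with p hp
  rcases hp with hp | hp
  · rw [hp]; exact min_le_left _ _
  · rw [hp]; exact min_le_right _ _

lemma isProbabilityMeasure_twoPoint {X : Type*} [MeasurableSpace X] (a b : X) :
    IsProbabilityMeasure ((2 : ℝ≥0∞)⁻¹ • (Measure.dirac a + Measure.dirac b)) :=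
  ⟨by simp [ENNReal.inv_two_add_inv_two]⟩

lemma twoPoint_mem_P2m (a b : E2) :
    (2 : ℝ≥0∞)⁻¹ • (Measure.dirac a + Measure.dirac b) ∈ P2m E2 := by
  refine ⟨isProbabilityMeasure_twoPoint a b, a, ?_⟩
  rw [lintegral_smul_measure, lintegral_add_measure, lintegral_dirac, lintegral_dirac, edist_self,
    smul_eq_mul]
  exact ENNReal.mul_lt_top (by simp) (by simp [edist_lt_top])

lemma add_sq_le_four_mul (a b : ℝ≥0∞) : (a + b) ^ 2 ≤ 4 * (a ^ 2 + b ^ 2) := by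
  wlog h : a ≤ b generalizing a b
  · rw [add_comm a, add_comm (a ^ 2)]
    exact this b a (le_of_not_ge h)
  calc (a + b) ^ 2 ≤ (b + b) ^ 2 := by gcongr
    _ = 4 * b ^ 2 := by ring
    _ ≤ 4 * (a ^ 2 + b ^ 2) := by gcongr; exact le_add_self

lemma lintegral_edist_sq_lt_top {ν : Measure E2} (hν : ν ∈ P2m E2) (a : E2) :
    ∫⁻ y, edist a y ^ 2 ∂ν < ⊤ := by
  obtain ⟨hp, x₀, hx⟩ := hν
  have key : ∀ y, edist a y ^ 2 ≤ 4 * (edist a x₀ ^ 2 + edist y x₀ ^ 2) := fun y =>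
    (pow_le_pow_left' (edist_triangle_right a y x₀) 2).trans (add_sq_le_four_mul _ _)
  refine (lintegral_mono key).trans_lt ?_
  rw [lintegral_const_mul _ (by fun_prop), lintegral_add_left (by fun_prop), lintegral_const,
    measure_univ, mul_one]
  exact ENNReal.mul_lt_top (by simp) (by simp [edist_lt_top, hx])

lemma minCost_twoPoint_lt_top {ν : Measure E2} (hν : ν ∈ P2m E2) (a b : E2) :
    minCost (fun x y => edist x y ^ 2) ((2 : ℝ≥0∞)⁻¹ • (Measure.dirac a + Measure.dirac b)) ν
      < ⊤ := by
  have := hν.1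
  have := isProbabilityMeasure_twoPoint a b
  set μ := (2 : ℝ≥0∞)⁻¹ • (Measure.dirac a + Measure.dirac b) with hμ
  have hγ : μ.prod ν ∈ couplings μ ν := by
    constructor
    · simp
    · simp
  refine (iInf₂_le _ hγ).trans_lt ?_
  rw [lintegral_prod _ (by fun_prop), hμ, lintegral_smul_measure, lintegral_add_measure,
    lintegral_dirac, lintegral_dirac, smul_eq_mul]
  exact ENNReal.mul_lt_top (by simp)
    (ENNReal.add_lt_top.2 ⟨lintegral_edist_sq_lt_top hν a, lintegral_edist_sq_lt_top hν b⟩)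

lemma edist_pt_sq (a b : ℝ) (y : E2) :
    edist (pt a b) y ^ 2 = ENNReal.ofReal ((a - y 0) ^ 2 + (b - y 1) ^ 2) := by
  rw [edist_dist, ← ENNReal.ofReal_pow dist_nonneg, EuclideanSpace.dist_sq_eq]
  simp [pt, Real.dist_eq, sq_abs]

lemma baryFun_eq (ν : Measure E2) :
    baryFun ν = (1 / 2) * (minCost (fun x y => edist x y ^ 2) muOne ν).toReal +
      (1 / 2) * (minCost (fun x y => edist x y ^ 2) muTwo ν).toReal := by
  simp only [baryFun, W2, Real.sq_sqrt ENNReal.toReal_nonneg]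

lemma two_inv_le_min_add_min (y : E2) :
    (2 : ℝ≥0∞)⁻¹ ≤ min (edist (pt 0 0) y ^ 2) (edist (pt 1 1) y ^ 2) +
      min (edist (pt 0 1) y ^ 2) (edist (pt 1 0) y ^ 2) := by
  have h2 : (2 : ℝ≥0∞)⁻¹ = ENNReal.ofReal (1 / 2) := by
    rw [one_div, ENNReal.ofReal_inv_of_pos two_pos, ENNReal.ofReal_ofNat]
  simp only [edist_pt_sq, h2]
  rcases min_choice (ENNReal.ofReal ((0 - y 0) ^ 2 + (0 - y 1) ^ 2))
    (ENNReal.ofReal ((1 - y 0) ^ 2 + (1 - y 1) ^ 2)) with h | h <;>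
  rcases min_choice (ENNReal.ofReal ((0 - y 0) ^ 2 + (1 - y 1) ^ 2))
    (ENNReal.ofReal ((1 - y 0) ^ 2 + (0 - y 1) ^ 2)) with h' | h' <;>
  rw [h, h', ← ENNReal.ofReal_add (by positivity) (by positivity)] <;>
  apply ENNReal.ofReal_le_ofReal <;>
  nlinarith [sq_nonneg (2 * y 0 - 1), sq_nonneg (2 * y 1 - 1), sq_nonneg (y 0),
    sq_nonneg (y 1), sq_nonneg (y 0 - 1), sq_nonneg (y 1 - 1)]

lemma le_baryFun {ν : Measure E2} (hν : ν ∈ P2m E2) : 1 / 4 ≤ baryFun ν := by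
  have := hν.1
  have h₁ : minCost (fun x y => edist x y ^ 2) muOne ν < ⊤ := minCost_twoPoint_lt_top hν _ _
  have h₂ : minCost (fun x y => edist x y ^ 2) muTwo ν < ⊤ := minCost_twoPoint_lt_top hν _ _
  have key : (2 : ℝ≥0∞)⁻¹ ≤ minCost (fun x y => edist x y ^ 2) muOne ν +
      minCost (fun x y => edist x y ^ 2) muTwo ν := by
    calc (2 : ℝ≥0∞)⁻¹ = ∫⁻ _, (2 : ℝ≥0∞)⁻¹ ∂ν := by simp
      _ ≤ ∫⁻ y, (min (edist (pt 0 0) y ^ 2) (edist (pt 1 1) y ^ 2) +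
          min (edist (pt 0 1) y ^ 2) (edist (pt 1 0) y ^ 2)) ∂ν :=
        lintegral_mono two_inv_le_min_add_min
      _ = ∫⁻ y, min (edist (pt 0 0) y ^ 2) (edist (pt 1 1) y ^ 2) ∂ν +
          ∫⁻ y, min (edist (pt 0 1) y ^ 2) (edist (pt 1 0) y ^ 2) ∂ν :=
        lintegral_add_left (by fun_prop) _
      _ ≤ _ := add_le_add
        (lintegral_min_le_minCost _ _ _ (by fun_prop) (by fun_prop) ν)
        (lintegral_min_le_minCost _ _ _ (by fun_prop) (by fun_prop) ν)
  have h := ENNReal.toReal_mono (ENNReal.add_lt_top.2 ⟨h₁, h₂⟩).ne key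
  rw [ENNReal.toReal_add h₁.ne h₂.ne, ENNReal.toReal_inv, ENNReal.toReal_ofNat] at h
  rw [baryFun_eq]
  linarith

lemma toReal_minCost_le_quarter {μ ν : Measure E2} {a b a' b' : E2}
    (hμ : μ = (2 : ℝ≥0∞)⁻¹ • (Measure.dirac a + Measure.dirac b))
    (hν : ν = (2 : ℝ≥0∞)⁻¹ • (Measure.dirac a' + Measure.dirac b'))
    (h : edist a a' ^ 2 = ENNReal.ofReal (1 / 4)) (h' : edist b b' ^ 2 = ENNReal.ofReal (1 / 4)) :
    (minCost (fun x y => edist x y ^ 2) μ ν).toReal ≤ 1 / 4 := by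
  refine ENNReal.toReal_le_of_le_ofReal (by norm_num) ?_
  rw [hμ, hν]
  refine (minCost_twoPoint_le _ a b a' b').trans (le_of_eq ?_)
  rw [h, h', ← two_mul, ← mul_assoc, ENNReal.inv_mul_cancel (by simp) (by simp), one_mul]

lemma baryFun_mOne_le : baryFun mOne ≤ 1 / 4 := by
  have h₁ := toReal_minCost_le_quarter (μ := muOne) (ν := mOne) rfl rfl
    (by rw [edist_pt_sq]; congr 1; simp [pt]; norm_num)
    (by rw [edist_pt_sq]; congr 1; simp [pt]; norm_num)
  have h₂ := toReal_minCost_le_quarter (μ := muTwo) (ν := mOne) rfl rfl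
    (by rw [edist_pt_sq]; congr 1; simp [pt]; norm_num)
    (by rw [edist_pt_sq]; congr 1; simp [pt]; norm_num)
  rw [baryFun_eq]
  linarith

lemma baryFun_mTwo_le : baryFun mTwo ≤ 1 / 4 := by
  have h₁ := toReal_minCost_le_quarter (μ := muOne) (ν := mTwo) rfl rfl
    (by rw [edist_pt_sq]; congr 1; simp [pt]; norm_num)
    (by rw [edist_pt_sq]; congr 1; simp [pt]; norm_num)
  have h₂ := toReal_minCost_le_quarter (μ := muTwo) (ν := mTwo) (a := pt 1 0) (b := pt 0 1)
    (a' := pt (1 / 2) 0) (b' := pt (1 / 2) 1)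
    (by rw [muTwo, add_comm]) rfl
    (by rw [edist_pt_sq]; congr 1; simp [pt]; norm_num)
    (by rw [edist_pt_sq]; congr 1; simp [pt]; norm_num)
  rw [baryFun_eq]
  linarith

lemma pt_injective {a b c d : ℝ} (h : pt a b = pt c d) : a = c ∧ b = d :=
  ⟨by simpa [pt] using congrArg (fun x : E2 => x 0) h,
    by simpa [pt] using congrArg (fun x : E2 => x 1) h⟩

lemma mOne_ne_mTwo : mOne ≠ mTwo := by
  intro h
  have h₁ : pt (1 / 2) 0 ≠ pt 0 (1 / 2) := fun e => by simpa using (pt_injective e).1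
  have h₂ : pt (1 / 2) 1 ≠ pt 0 (1 / 2) := fun e => by simpa using (pt_injective e).1
  have hs := congrArg (fun μ : Measure E2 => μ {pt 0 (1 / 2)}) h
  simp only [mOne, mTwo, Measure.smul_apply, Measure.add_apply, smul_eq_mul,
    Measure.dirac_apply, Set.indicator_apply, Set.mem_singleton_iff, h₁, h₂, if_true, if_false,
    add_zero, mul_zero, Pi.one_apply] at hs
  simp at hs

/-- Both `m¹` and `m²` minimize `ν ↦ ½W₂²(μ¹,ν) + ½W₂²(μ²,ν)`
over `P₂(ℝ²)`; in particular the equally weighted 2-Wasserstein barycenter of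
`μ¹` and `μ²` is not unique. -/
theorem barycenter_not_unique :
    mOne ∈ P2m E2 ∧ mTwo ∈ P2m E2 ∧
    (∀ ν ∈ P2m E2, baryFun mOne ≤ baryFun ν) ∧
    (∀ ν ∈ P2m E2, baryFun mTwo ≤ baryFun ν) ∧
    mOne ≠ mTwo := by
  exact ⟨twoPoint_mem_P2m _ _, twoPoint_mem_P2m _ _,
    fun _ hν => baryFun_mOne_le.trans (le_baryFun hν),
    fun _ hν => baryFun_mTwo_le.trans (le_baryFun hν), mOne_ne_mTwo⟩

end
end
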